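/- Let the two-dimensional torus (ℂ*)² act on ℂ[x₁,...,x₁₂] by ℂ-algebra automorphisms, where (λ,μ) acts on x₁,...,x₆ by x₁ ↦ λμ⁻¹x₁, x₂ ↦ λx₂, x₃ ↦ μx₃, x₄ ↦ λ⁻¹μx₄, x₅ ↦ λ⁻¹x₅, x₆ ↦ μ⁻¹x₆, and acts on x₇,...,x₁₂ with the same weights as on x₁,...,x₆ respectively (i.e. x_{i+6} transforms like x_i for 1 ≤ i ≤ 6). Then a polynomial f ∈ ℂ[x₁,...,x₁₂] is invariant under this action for all (λ,μ) ∈ (ℂ*)² if and only if f lies in the ℂ-subalgebra generated by the monomials x_a x_b with a ∈ {1,7}, b ∈ {4,10}, the monomials x_a x_b with a ∈ {2,8}, b ∈ {5,11}, the monomials x_a x_b with a ∈ {3,9}, b ∈ {6,12}, the monomials x_a x_b x_c with a ∈ {1,7}, b ∈ {3,9}, c ∈ {5,11}, and the monomials x_a x_b x_c with a ∈ {2,8}, b ∈ {4,10}, c ∈ {6,12}. -/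

import Mathlib

open MvPolynomial

namespace StokesTorus

/-- The weight of each variable under the torus element `(l, m)`. -/
noncomputable def weight (l m : ℂ) : Fin 12 → ℂ :=
  ![l * m⁻¹, l, m, l⁻¹ * m, l⁻¹, m⁻¹,
    l * m⁻¹, l, m, l⁻¹ * m, l⁻¹, m⁻¹]

/-- The monomials generating the ring of invariants. -/
def generators : Set (MvPolynomial (Fin 12) ℂ) :=
  {X 0 * X 3, X 0 * X 9, X 6 * X 3, X 6 * X 9,
      X 1 * X 4, X 1 * X 10, X 7 * X 4, X 7 * X 10,
      X 2 * X 5, X 2 * X 11, X 8 * X 5, X 8 * X 11,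
      X 0 * X 2 * X 4, X 0 * X 2 * X 10, X 0 * X 8 * X 4, X 0 * X 8 * X 10,
      X 6 * X 2 * X 4, X 6 * X 2 * X 10, X 6 * X 8 * X 4, X 6 * X 8 * X 10,
      X 1 * X 3 * X 5, X 1 * X 3 * X 11, X 1 * X 9 * X 5, X 1 * X 9 * X 11,
      X 7 * X 3 * X 5, X 7 * X 3 * X 11, X 7 * X 9 * X 5, X 7 * X 9 * X 11}

/-- An exponent vector is balanced when both exponents of its torus character vanish. -/
def Balanced (d : Fin 12 →₀ ℕ) : Prop :=
  d 0 + d 6 + (d 1 + d 7) = d 3 + d 9 + (d 4 + d 10) ∧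
    d 2 + d 8 + (d 3 + d 9) = d 0 + d 6 + (d 5 + d 11)

lemma coeff_aeval_C_mul_X {σ R : Type*} [CommSemiring R] (c : σ → R) (f : MvPolynomial σ R)
    (d : σ →₀ ℕ) :
    coeff d (aeval (fun i => C (c i) * X i) f) = coeff d f * d.prod fun i k => c i ^ k := by
  classical
  induction f using MvPolynomial.induction_on' with
  | add p q hp hq => rw [map_add, coeff_add, coeff_add, hp, hq, add_mul]
  | monomial e a =>
    have h : aeval (fun i => C (c i) * X i) (monomial e a) =
        monomial e (a * e.prod fun i k => c i ^ k) := by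
      rw [aeval_monomial, algebraMap_eq, monomial_eq, C_mul, mul_assoc]
      simp only [Finsupp.prod, mul_pow, Finset.prod_mul_distrib, map_prod, map_pow]
    rw [h, coeff_monomial, coeff_monomial]
    split_ifs with hed
    · rw [hed]
    · rw [zero_mul]

lemma prod_weight (l m : ℂ) (d : Fin 12 →₀ ℕ) :
    (d.prod fun i k => weight l m i ^ k) =
      (l * m⁻¹) ^ (d 0 + d 6) * l ^ (d 1 + d 7) * m ^ (d 2 + d 8) *
        (l⁻¹ * m) ^ (d 3 + d 9) * l⁻¹ ^ (d 4 + d 10) * m⁻¹ ^ (d 5 + d 11) := by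
  rw [Finsupp.prod_fintype _ _ fun _ => pow_zero _]
  simp only [Fin.prod_univ_succ, weight]
  simp [pow_add]
  ring

lemma balanced_of_prod_weight_eq_one {d : Fin 12 →₀ ℕ}
    (h : ∀ l m : ℂ, l ≠ 0 → m ≠ 0 → (d.prod fun i k => weight l m i ^ k) = 1) :
    Balanced d := by
  have inj : ∀ {a b : ℕ}, (2 : ℂ) ^ a * 2⁻¹ ^ b = 1 → a = b := by
    intro a b hab
    rw [inv_pow, mul_inv_eq_one₀ (pow_ne_zero _ two_ne_zero)] at hab
    exact Nat.pow_right_injective le_rfl (by exact_mod_cast hab)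
  have h₁ := h 2 1 two_ne_zero one_ne_zero
  have h₂ := h 1 2 one_ne_zero two_ne_zero
  rw [prod_weight] at h₁ h₂
  refine ⟨inj ?_, inj ?_⟩
  · rw [← h₁]
    simp only [inv_one, mul_one, one_pow, pow_add]
    ring
  · rw [← h₂]
    simp only [inv_one, one_mul, one_pow, pow_add]
    ring

lemma Balanced.tsub {d g : Fin 12 →₀ ℕ} (hd : Balanced d) (hg : Balanced g) (h : g ≤ d) :
    Balanced (d - g) := by
  have h' : ∀ i, (d - g) i + g i = d i := fun i => by
    rw [← Finsupp.add_apply, tsub_add_cancel_of_le h]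
  obtain ⟨hd₁, hd₂⟩ := hd
  obtain ⟨hg₁, hg₂⟩ := hg
  have := h' 0; have := h' 1; have := h' 2; have := h' 3
  have := h' 4; have := h' 5; have := h' 6; have := h' 7
  have := h' 8; have := h' 9; have := h' 10; have := h' 11
  constructor <;> omega

set_option maxHeartbeats 1000000 in
/-- A nonzero balanced exponent vector is divisible by the exponent of a generator. -/
lemma Balanced.exists_generator_le {d : Fin 12 →₀ ℕ} (hd : Balanced d) (h0 : d ≠ 0) :
    ∃ g ≤ d, g ≠ 0 ∧ Balanced g ∧ monomial g (1 : ℂ) ∈ generators := by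
  have pair : ∀ i j : Fin 12, i ≠ j → 0 < d i → 0 < d j →
      Balanced (.single i 1 + .single j 1) → (X i * X j : MvPolynomial (Fin 12) ℂ) ∈ generators →
      ∃ g ≤ d, g ≠ 0 ∧ Balanced g ∧ monomial g (1 : ℂ) ∈ generators := by
    intro i j hij hi hj hb hg
    refine ⟨_, fun k => ?_, fun h => ?_, hb, ?_⟩
    · simp only [Finsupp.add_apply, Finsupp.single_apply]
      split_ifs <;> grind
    · simpa using DFunLike.congr_fun h i
    · simpa [X, monomial_mul] using hg
  have triple : ∀ i j k : Fin 12, i ≠ j → i ≠ k → j ≠ k → 0 < d i → 0 < d j → 0 < d k →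
      Balanced (.single i 1 + .single j 1 + .single k 1) →
      (X i * X j * X k : MvPolynomial (Fin 12) ℂ) ∈ generators →
      ∃ g ≤ d, g ≠ 0 ∧ Balanced g ∧ monomial g (1 : ℂ) ∈ generators := by
    intro i j k hij hik hjk hi hj hk hb hg
    refine ⟨_, fun n => ?_, fun h => ?_, hb, ?_⟩
    · simp only [Finsupp.add_apply, Finsupp.single_apply]
      split_ifs <;> grind
    · simpa using DFunLike.congr_fun h i
    · simpa [X, monomial_mul] using hg
  have hne : ∃ i, 0 < d i := by
    by_contra! h
    exact h0 (Finsupp.ext fun i => Nat.le_zero.mp (h i))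
  have hsupp : ((0 < d 0 ∨ 0 < d 6) ∧ (0 < d 3 ∨ 0 < d 9)) ∨
      ((0 < d 1 ∨ 0 < d 7) ∧ (0 < d 4 ∨ 0 < d 10)) ∨
      ((0 < d 2 ∨ 0 < d 8) ∧ (0 < d 5 ∨ 0 < d 11)) ∨
      ((0 < d 0 ∨ 0 < d 6) ∧ (0 < d 2 ∨ 0 < d 8) ∧ (0 < d 4 ∨ 0 < d 10)) ∨
      ((0 < d 1 ∨ 0 < d 7) ∧ (0 < d 3 ∨ 0 < d 9) ∧ (0 < d 5 ∨ 0 < d 11)) := by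
    obtain ⟨hd₁, hd₂⟩ := hd
    obtain ⟨i, hi⟩ := hne
    fin_cases i <;> simp only [Fin.reduceFinMk, Fin.zero_eta, Fin.mk_one] at hi <;> omega
  rcases hsupp with ⟨hi | hi, hj | hj⟩ | ⟨hi | hi, hj | hj⟩ | ⟨hi | hi, hj | hj⟩ |
    ⟨hi | hi, hj | hj, hk | hk⟩ | ⟨hi | hi, hj | hj, hk | hk⟩
  all_goals first
    | exact triple _ _ _ (by decide) (by decide) (by decide) hi hj hk (by simp [Balanced])
        (by simp only [generators, Set.mem_insert_iff, Set.mem_singleton_iff, true_or, or_true])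
    | exact pair _ _ (by decide) hi hj (by simp [Balanced])
        (by simp only [generators, Set.mem_insert_iff, Set.mem_singleton_iff, true_or, or_true])

lemma monomial_mem_adjoin_generators {d : Fin 12 →₀ ℕ} (hd : Balanced d) :
    monomial d (1 : ℂ) ∈ Algebra.adjoin ℂ generators := by
  induction hn : d.degree using Nat.strong_induction_on generalizing d with
  | _ n ih =>
    rcases eq_or_ne d 0 with rfl | h0
    · exact one_mem _
    · obtain ⟨g, hgd, hg0, hgb, hg⟩ := hd.exists_generator_le h0
      have hdeg : (d - g).degree + g.degree = n := by
        rw [← map_add, tsub_add_cancel_of_le hgd, hn]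
      have hpos : g.degree ≠ 0 := fun h => hg0 ((Finsupp.degree_eq_zero_iff g).mp h)
      have hmul := mul_mem (ih _ (by omega) (hd.tsub hgb hgd) rfl) (Algebra.subset_adjoin hg)
      rwa [monomial_mul, tsub_add_cancel_of_le hgd, one_mul] at hmul

lemma aeval_generator {l m : ℂ} (hl : l ≠ 0) (hm : m ≠ 0) {p : MvPolynomial (Fin 12) ℂ}
    (hp : p ∈ generators) : aeval (fun i => C (weight l m i) * X i) p = p := by
  have pair : ∀ i j : Fin 12, weight l m i * weight l m j = 1 →
      aeval (fun i => C (weight l m i) * X i) (X i * X j : MvPolynomial (Fin 12) ℂ) =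
        X i * X j := by
    intro i j h
    rw [map_mul, aeval_X, aeval_X, mul_mul_mul_comm, ← C_mul, h, C_1, one_mul]
  have triple : ∀ i j k : Fin 12, weight l m i * weight l m j * weight l m k = 1 →
      aeval (fun i => C (weight l m i) * X i) (X i * X j * X k : MvPolynomial (Fin 12) ℂ) =
        X i * X j * X k := by
    intro i j k h
    rw [map_mul, map_mul, aeval_X, aeval_X, aeval_X, mul_mul_mul_comm (C _),
      mul_mul_mul_comm (C _ * C _), ← C_mul, ← C_mul, h, C_1, one_mul]
  simp only [generators, Set.mem_insert_iff, Set.mem_singleton_iff] at hp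
  iterate 12
    rcases hp with rfl | hp
    · exact pair _ _ (by simp [weight]; try field_simp)
  iterate 15
    rcases hp with rfl | hp
    · exact triple _ _ _ (by simp [weight]; try field_simp)
  subst hp
  exact triple _ _ _ (by simp [weight]; try field_simp)

end StokesTorus

open StokesTorus
/-- The torus (ℂ*)² acts on ℂ[x₁,...,x₁₂] with the same weights on x_{i+6} as on x_i.
A polynomial is invariant iff it lies in the subalgebra generated by the listed monomials. -/
theorem stmt_1 (f : MvPolynomial (Fin 12) ℂ) :
    (∀ l m : ℂ, l ≠ 0 → m ≠ 0 →
      aeval (fun i : Fin 12 =>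
        C (![l * m⁻¹, l, m, l⁻¹ * m, l⁻¹, m⁻¹,
             l * m⁻¹, l, m, l⁻¹ * m, l⁻¹, m⁻¹] i) * X i) f = f) ↔
    f ∈ Algebra.adjoin ℂ
      ({X 0 * X 3, X 0 * X 9, X 6 * X 3, X 6 * X 9,
        X 1 * X 4, X 1 * X 10, X 7 * X 4, X 7 * X 10,
        X 2 * X 5, X 2 * X 11, X 8 * X 5, X 8 * X 11,
        X 0 * X 2 * X 4, X 0 * X 2 * X 10, X 0 * X 8 * X 4, X 0 * X 8 * X 10,
        X 6 * X 2 * X 4, X 6 * X 2 * X 10, X 6 * X 8 * X 4, X 6 * X 8 * X 10,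
        X 1 * X 3 * X 5, X 1 * X 3 * X 11, X 1 * X 9 * X 5, X 1 * X 9 * X 11,
        X 7 * X 3 * X 5, X 7 * X 3 * X 11, X 7 * X 9 * X 5, X 7 * X 9 * X 11} :
        Set (MvPolynomial (Fin 12) ℂ)) := by
  change (∀ l m : ℂ, l ≠ 0 → m ≠ 0 → aeval (fun i => C (weight l m i) * X i) f = f) ↔
    f ∈ Algebra.adjoin ℂ generators
  constructor
  · intro h
    rw [f.as_sum]
    refine sum_mem fun d hd => ?_
    have hb : Balanced d := by
      refine balanced_of_prod_weight_eq_one fun l m hl hm => ?_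
      have hc := congrArg (coeff d) (h l m hl hm)
      rw [coeff_aeval_C_mul_X] at hc
      exact mul_eq_left₀ (mem_support_iff.mp hd) |>.mp hc
    have hs := Subalgebra.smul_mem _ (monomial_mem_adjoin_generators hb) (coeff d f)
    rwa [smul_monomial, smul_eq_mul, mul_one] at hs
  · intro hf l m hl hm
    have hle : Algebra.adjoin ℂ generators ≤
        AlgHom.equalizer (aeval fun i => C (weight l m i) * X i) (AlgHom.id ℂ _) :=
      Algebra.adjoin_le fun p hp => aeval_generator hl hm hp
    exact hle hf
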